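/- Suppose |c₁/(𝓜·exp(−0.5)) − 1| < |c₁/(𝔐·exp(−0.5)) − 1|. Then for any V̄ ∈ ℝ^{m×c₁} and Ṽ ∈ ℝ^{m×c₂}: ‖exp(Q̄)exp(K̄)ᵀ − exp(Q̄K̄ᵀ) ⊙ exp(Q̃K̃ᵀ)‖_F · ‖V̄‖_F + ‖exp(Q̃K̃ᵀ) ⊙ Z − exp(Q̄K̄ᵀ) ⊙ exp(Q̃K̃ᵀ)‖_F · ‖Ṽ‖_F ≤ ((c₁/(𝓜·exp(−0.5))) · ‖U_m − exp(Q̃K̃ᵀ)‖_F + |c₁/(𝔐·exp(−0.5)) − 1| · ‖exp(Q̃K̃ᵀ)‖_F) · ‖exp(Q̄K̄ᵀ)‖_F · ‖V̄‖_F + ‖Z − exp(Q̄K̄ᵀ)‖_F · ‖exp(Q̃K̃ᵀ)‖_F · ‖Ṽ‖_F. -/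

import Mathlib

open Matrix Finset

/-- Entrywise exponential of a real matrix. -/
noncomputable def eexp {α β : Type*} (A : Matrix α β ℝ) : Matrix α β ℝ := A.map Real.exp

/-- Frobenius norm of a real matrix. -/
noncomputable def frob {α β : Type*} [Fintype α] [Fintype β] (A : Matrix α β ℝ) : ℝ :=
  Real.sqrt (∑ i, ∑ j, (A i j) ^ 2)

/-- The all-ones square matrix. -/
def allOnes (α : Type*) : Matrix α α ℝ := Matrix.of fun _ _ => 1

/-- 𝔐: the maximum of exp(⟨q̄ᵢ₁, k̄ᵢ₂⟩ + 0.5 − (q̄ᵢ₁ⱼ + k̄ᵢ₂ⱼ)). -/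
noncomputable def bigM {ι : Type*} [Fintype ι] [Nonempty ι] {c₁ : ℕ} [NeZero c₁]
    (Q K : Matrix ι (Fin c₁) ℝ) : ℝ :=
  Finset.univ.sup' Finset.univ_nonempty fun p : ι × ι × Fin c₁ =>
    Real.exp ((∑ j, Q p.1 j * K p.2.1 j) + 0.5 - (Q p.1 p.2.2 + K p.2.1 p.2.2))

/-- 𝓜: the minimum of exp(⟨q̄ᵢ₁, k̄ᵢ₂⟩ + 0.5 − (q̄ᵢ₁ⱼ + k̄ᵢ₂ⱼ)). -/
noncomputable def smallM {ι : Type*} [Fintype ι] [Nonempty ι] {c₁ : ℕ} [NeZero c₁]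
    (Q K : Matrix ι (Fin c₁) ℝ) : ℝ :=
  Finset.univ.inf' Finset.univ_nonempty fun p : ι × ι × Fin c₁ =>
    Real.exp ((∑ j, Q p.1 j * K p.2.1 j) + 0.5 - (Q p.1 p.2.2 + K p.2.1 p.2.2))

/-- Z = I_b ⊗ U_p : the block-diagonal 0/1 mask with b diagonal all-ones p×p blocks. -/
def blockZ (b p : ℕ) : Matrix (Fin b × Fin p) (Fin b × Fin p) ℝ :=
  Matrix.kroneckerMap (· * ·) (1 : Matrix (Fin b) (Fin b) ℝ) (allOnes (Fin p))

section Frobenius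

variable {α β : Type*} [Fintype α] [Fintype β]

theorem frob_nonneg (A : Matrix α β ℝ) : 0 ≤ frob A := Real.sqrt_nonneg _

theorem frob_le_mul_frob {A B : Matrix α β ℝ} {c : ℝ} (hc : 0 ≤ c)
    (h : ∀ i j, |A i j| ≤ c * |B i j|) : frob A ≤ c * frob B := by
  refine Real.sqrt_le_iff.2 ⟨mul_nonneg hc (frob_nonneg B), ?_⟩
  rw [mul_pow, frob, Real.sq_sqrt (by positivity), Finset.mul_sum]
  refine Finset.sum_le_sum fun i _ => ?_
  rw [Finset.mul_sum]
  refine Finset.sum_le_sum fun j _ => ?_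
  rw [← sq_abs, ← sq_abs (B i j), ← mul_pow]
  gcongr
  exact h i j

theorem frob_add_le (A B : Matrix α β ℝ) : frob (A + B) ≤ frob A + frob B := by
  let := Matrix.frobeniusNormedAddCommGroup (m := α) (n := β) (α := ℝ)
  have key (C : Matrix α β ℝ) : frob C = ‖C‖ := by
    rw [Matrix.frobenius_norm_def, frob, Real.sqrt_eq_rpow]
    simp
  simpa only [key] using norm_add_le A B

theorem abs_apply_le_frob (A : Matrix α β ℝ) (i : α) (j : β) : |A i j| ≤ frob A := by
  refine Real.abs_le_sqrt ?_
  calc (A i j) ^ 2 ≤ ∑ j, (A i j) ^ 2 :=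
        Finset.single_le_sum (f := fun j => (A i j) ^ 2) (fun _ _ => sq_nonneg _)
          (Finset.mem_univ j)
    _ ≤ ∑ i, ∑ j, (A i j) ^ 2 :=
        Finset.single_le_sum (f := fun i => ∑ j, (A i j) ^ 2)
          (fun _ _ => Finset.sum_nonneg fun _ _ => sq_nonneg _) (Finset.mem_univ i)

theorem frob_hadamard_le (A B : Matrix α β ℝ) : frob (A.hadamard B) ≤ frob A * frob B :=
  frob_le_mul_frob (frob_nonneg A) fun i j => by
    rw [Matrix.hadamard_apply, abs_mul]
    exact mul_le_mul_of_nonneg_right (abs_apply_le_frob A i j) (abs_nonneg _)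

end Frobenius

section Kernel

variable {ι : Type*} [Fintype ι] [Nonempty ι] {c : ℕ} [NeZero c] (Q K : Matrix ι (Fin c) ℝ)

theorem bigM_pos : 0 < bigM Q K := by
  obtain ⟨p, -, hp⟩ := Finset.exists_mem_eq_sup' Finset.univ_nonempty
    fun p : ι × ι × Fin c =>
      Real.exp ((∑ j, Q p.1 j * K p.2.1 j) + 0.5 - (Q p.1 p.2.2 + K p.2.1 p.2.2))
  exact (Real.exp_pos _).trans_eq hp.symm

theorem smallM_pos : 0 < smallM Q K :=
  (Finset.lt_inf'_iff _).2 fun _ _ => Real.exp_pos _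

theorem eexp_mul_mem_Icc (i j : ι) :
    (eexp Q * (eexp K)ᵀ) i j ∈
      Set.Icc ((c : ℝ) / (bigM Q K * Real.exp (-0.5)) * eexp (Q * Kᵀ) i j)
        ((c : ℝ) / (smallM Q K * Real.exp (-0.5)) * eexp (Q * Kᵀ) i j) := by
  have hS := bigM_pos Q K
  have hs := smallM_pos Q K
  have he := Real.exp_pos (-0.5)
  have hsum : (eexp Q * (eexp K)ᵀ) i j = ∑ l, Real.exp (Q i l + K j l) := by
    simp [eexp, Matrix.mul_apply, Real.exp_add]
  have hterm (l : Fin c) :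
      Real.exp ((∑ l, Q i l * K j l) + 0.5 - (Q i l + K j l)) *
        (Real.exp (Q i l + K j l) * Real.exp (-0.5)) = eexp (Q * Kᵀ) i j := by
    rw [← Real.exp_add, ← Real.exp_add]
    simp only [eexp, Matrix.map_apply, Matrix.mul_apply, Matrix.transpose_apply]
    congr 1
    ring
  have hle (l : Fin c) := Finset.le_sup' (fun p : ι × ι × Fin c =>
    Real.exp ((∑ j, Q p.1 j * K p.2.1 j) + 0.5 - (Q p.1 p.2.2 + K p.2.1 p.2.2)))
    (Finset.mem_univ (i, j, l))
  have hge (l : Fin c) := Finset.inf'_le (fun p : ι × ι × Fin c =>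
    Real.exp ((∑ j, Q p.1 j * K p.2.1 j) + 0.5 - (Q p.1 p.2.2 + K p.2.1 p.2.2)))
    (Finset.mem_univ (i, j, l))
  have hconst (x : ℝ) : (c : ℝ) / x * eexp (Q * Kᵀ) i j =
      ∑ _l : Fin c, eexp (Q * Kᵀ) i j / x := by
    rw [Finset.sum_const, Finset.card_univ, Fintype.card_fin, nsmul_eq_mul]
    ring
  rw [hsum, hconst, hconst]
  constructor
  · refine Finset.sum_le_sum fun l _ => ?_
    rw [div_le_iff₀ (by positivity), ← hterm l]
    calc _ ≤ bigM Q K * (Real.exp (Q i l + K j l) * Real.exp (-0.5)) :=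
          mul_le_mul_of_nonneg_right (hle l) (by positivity)
      _ = _ := by ring
  · refine Finset.sum_le_sum fun l _ => ?_
    rw [le_div_iff₀ (by positivity), ← hterm l]
    calc _ = smallM Q K * (Real.exp (Q i l + K j l) * Real.exp (-0.5)) := by ring
      _ ≤ _ := mul_le_mul_of_nonneg_right (hge l) (by positivity)

theorem frob_eexp_mul_le :
    frob (eexp Q * (eexp K)ᵀ) ≤
      (c : ℝ) / (smallM Q K * Real.exp (-0.5)) * frob (eexp (Q * Kᵀ)) := by
  have hs := smallM_pos Q K
  have hS := bigM_pos Q K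
  refine frob_le_mul_frob (by positivity) fun i j => ?_
  obtain ⟨hl, hu⟩ := eexp_mul_mem_Icc Q K i j
  have hpos : 0 < eexp (Q * Kᵀ) i j := Real.exp_pos _
  rwa [abs_of_pos hpos, abs_of_nonneg (le_trans (by positivity) hl)]

theorem frob_eexp_mul_sub_le
    (h : |(c : ℝ) / (smallM Q K * Real.exp (-0.5)) - 1| ≤
      |(c : ℝ) / (bigM Q K * Real.exp (-0.5)) - 1|) :
    frob (eexp Q * (eexp K)ᵀ - eexp (Q * Kᵀ)) ≤
      |(c : ℝ) / (bigM Q K * Real.exp (-0.5)) - 1| * frob (eexp (Q * Kᵀ)) := by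
  refine frob_le_mul_frob (abs_nonneg _) fun i j => ?_
  obtain ⟨hl, hu⟩ := eexp_mul_mem_Icc Q K i j
  have hpos : 0 < eexp (Q * Kᵀ) i j := Real.exp_pos _
  rw [Matrix.sub_apply, abs_of_pos hpos, abs_le]
  constructor
  · nlinarith [neg_abs_le ((c : ℝ) / (bigM Q K * Real.exp (-0.5)) - 1)]
  · nlinarith [(le_abs_self _).trans h]

end Kernel

/-- if |c₁/(𝓜e) − 1| < |c₁/(𝔐e) − 1| (with e = exp(−0.5)), then
‖exp(Q̄)exp(K̄)ᵀ − exp(Q̄K̄ᵀ) ⊙ exp(Q̃K̃ᵀ)‖_F ‖V̄‖_F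
+ ‖exp(Q̃K̃ᵀ) ⊙ Z − exp(Q̄K̄ᵀ) ⊙ exp(Q̃K̃ᵀ)‖_F ‖Ṽ‖_F ≤
((c₁/(𝓜e)) ‖U_m − exp(Q̃K̃ᵀ)‖_F + |c₁/(𝔐e) − 1| ‖exp(Q̃K̃ᵀ)‖_F) ‖exp(Q̄K̄ᵀ)‖_F ‖V̄‖_F
+ ‖Z − exp(Q̄K̄ᵀ)‖_F ‖exp(Q̃K̃ᵀ)‖_F ‖Ṽ‖_F. -/
theorem stmt_13 (b p c₁ c₂ : ℕ) [NeZero b] [NeZero p] [NeZero c₁] [NeZero c₂]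
    (Qb Kb : Matrix (Fin b × Fin p) (Fin c₁) ℝ)
    (Qt Kt : Matrix (Fin b × Fin p) (Fin c₂) ℝ)
    (h : |(c₁ : ℝ) / (smallM Qb Kb * Real.exp (-0.5)) - 1| <
        |(c₁ : ℝ) / (bigM Qb Kb * Real.exp (-0.5)) - 1|)
    (Vb : Matrix (Fin b × Fin p) (Fin c₁) ℝ) (Vt : Matrix (Fin b × Fin p) (Fin c₂) ℝ) :
    frob (eexp Qb * (eexp Kb)ᵀ - (eexp (Qb * Kbᵀ)).hadamard (eexp (Qt * Ktᵀ))) * frob Vb +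
        frob ((eexp (Qt * Ktᵀ)).hadamard (blockZ b p) -
            (eexp (Qb * Kbᵀ)).hadamard (eexp (Qt * Ktᵀ))) * frob Vt ≤
      ((c₁ : ℝ) / (smallM Qb Kb * Real.exp (-0.5)) *
            frob (allOnes (Fin b × Fin p) - eexp (Qt * Ktᵀ)) +
          |(c₁ : ℝ) / (bigM Qb Kb * Real.exp (-0.5)) - 1| * frob (eexp (Qt * Ktᵀ))) *
          frob (eexp (Qb * Kbᵀ)) * frob Vb +
        frob (blockZ b p - eexp (Qb * Kbᵀ)) * frob (eexp (Qt * Ktᵀ)) * frob Vt := by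
  set S := eexp (Qb * Kbᵀ)
  set E := eexp (Qt * Ktᵀ)
  set T := eexp Qb * (eexp Kb)ᵀ
  have hsplit : T - S.hadamard E =
      T.hadamard (allOnes (Fin b × Fin p) - E) + (T - S).hadamard E := by
    ext i j
    simp only [Matrix.sub_apply, Matrix.add_apply, Matrix.hadamard_apply, allOnes,
      Matrix.of_apply]
    ring
  have hfactor : E.hadamard (blockZ b p) - S.hadamard E = (blockZ b p - S).hadamard E := by
    ext i j
    simp only [Matrix.sub_apply, Matrix.hadamard_apply]
    ring
  have hlow := (frob_hadamard_le T (allOnes (Fin b × Fin p) - E)).trans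
    (mul_le_mul_of_nonneg_right (frob_eexp_mul_le Qb Kb) (frob_nonneg _))
  have hdiff := (frob_hadamard_le (T - S) E).trans
    (mul_le_mul_of_nonneg_right (frob_eexp_mul_sub_le Qb Kb h.le) (frob_nonneg _))
  rw [hsplit, hfactor]
  refine add_le_add (mul_le_mul_of_nonneg_right ?_ (frob_nonneg _))
    (mul_le_mul_of_nonneg_right (frob_hadamard_le _ _) (frob_nonneg _))
  refine (frob_add_le _ _).trans ((add_le_add hlow hdiff).trans_eq ?_)
  ring
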